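/- arXiv:1407.8227 — 3 statements merged into one kernel-verified Lean document; each statement's English description precedes it below -/
import Mathlib

section
/- Let K be a field of characteristic 0 and let L be a finite-dimensional Lie algebra over K. If for every pair of elements x, y ∈ L the Lie subalgebra of L generated by {x, y} is supersolvable, then L is supersolvable. -/
/-- A finite-dimensional Lie algebra is supersolvable if it admits a chain of
Lie ideals `0 = I₀ ⊆ I₁ ⊆ ⋯ ⊆ Iₙ = L` with `dim Iⱼ = j` for each `j`. -/
def LieAlgebra.IsSupersolvable (K : Type*) (L : Type*) [Field K] [LieRing L]
    [LieAlgebra K L] : Prop :=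
  ∃ (n : ℕ) (I : ℕ → LieIdeal K L),
    I 0 = ⊥ ∧ I n = ⊤ ∧ (∀ j, j < n → I j ≤ I (j + 1)) ∧
    ∀ j, j ≤ n → Module.finrank K (I j) = j

namespace Module.End

variable {K V W : Type*} [Field K] [AddCommGroup V] [Module K V] [AddCommGroup W] [Module K W]

lemma map_iSup_maxGenEigenspace_le (f : V →ₗ[K] W) {a : End K V} {b : End K W}
    (h : ∀ v, f (a v) = b (f v)) :
    (⨆ μ, a.maxGenEigenspace μ).map f ≤ ⨆ μ, b.maxGenEigenspace μ := by
  rw [Submodule.map_iSup]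
  refine iSup_mono fun μ ↦ ?_
  rintro _ ⟨v, hv, rfl⟩
  obtain ⟨k, hk⟩ := (mem_maxGenEigenspace a μ v).1 hv
  refine (mem_maxGenEigenspace b μ _).2 ⟨k, ?_⟩
  have key : ∀ n : ℕ, ∀ v, f (((a - μ • (1 : End K V)) ^ n) v)
      = ((b - μ • (1 : End K W)) ^ n) (f v) := by
    intro n
    induction n with
    | zero => simp
    | succ n ih => intro v; simp [pow_succ, ih, h]
  rw [← key, hk, map_zero]

lemma maxGenEigenspace_le_map_sub [FiniteDimensional K V] (f : End K V) {c μ : K} (h : μ ≠ c) :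
    f.maxGenEigenspace μ ≤ (f.maxGenEigenspace μ).map (f - c • (1 : End K V)) := by
  refine (Submodule.eq_of_le_of_finrank_eq ?_ ?_).ge
  · rintro _ ⟨v, hv, rfl⟩
    simp only [LinearMap.sub_apply, LinearMap.smul_apply, one_apply]
    exact sub_mem (mapsTo_maxGenEigenspace_of_comm (Commute.refl f) μ hv)
      (Submodule.smul_mem _ _ hv)
  · rw [← LinearMap.range_domRestrict]
    refine LinearMap.finrank_range_of_inj ?_
    rw [← LinearMap.ker_eq_bot, LinearMap.ker_eq_bot']
    rintro ⟨v, hv⟩ h0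
    have hvc : v ∈ f.maxGenEigenspace c := (mem_maxGenEigenspace f c v).2 ⟨1, by simpa using h0⟩
    exact Subtype.ext (Submodule.disjoint_def.1 (disjoint_genEigenspace f h ⊤ ⊤) v hv hvc)

lemma mem_iSup_maxGenEigenspace_of_sub_mem [FiniteDimensional K V] (f : End K V) {c : K} {v : V}
    (h : f v - c • v ∈ ⨆ μ, f.maxGenEigenspace μ) :
    v ∈ ⨆ μ, f.maxGenEigenspace μ := by
  set T := ⨆ μ, f.maxGenEigenspace μ
  have hle : T ≤ T.map (f - c • (1 : End K V)) ⊔ f.maxGenEigenspace c := by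
    refine iSup_le fun μ ↦ ?_
    by_cases hμ : μ = c
    · subst hμ; exact le_sup_right
    · exact (maxGenEigenspace_le_map_sub f hμ).trans
        ((Submodule.map_mono (le_iSup _ μ)).trans le_sup_left)
  obtain ⟨_, ⟨u, hu, rfl⟩, e, he, hue⟩ := Submodule.mem_sup.1 (hle h)
  have hvu : v - u ∈ f.maxGenEigenspace c := by
    obtain ⟨k, hk⟩ := (mem_maxGenEigenspace f c e).1 he
    refine (mem_maxGenEigenspace f c _).2 ⟨k + 1, ?_⟩
    have : (f - c • (1 : End K V)) (v - u) = e := by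
      rw [map_sub, sub_eq_iff_eq_add', hue]
      simp
    rw [pow_succ, mul_apply, this, hk]
  have := add_mem (le_iSup f.maxGenEigenspace c hvu) hu
  simpa using this

end Module.End

lemma Submodule.exists_eq_sup_span_singleton {K V : Type*} [Field K] [AddCommGroup V] [Module K V]
    [FiniteDimensional K V] {A B : Submodule K V} (hAB : A ≤ B)
    (h : Module.finrank K B = Module.finrank K A + 1) :
    ∃ w, B = A ⊔ K ∙ w := by
  have hlt : A < B := lt_of_le_of_ne hAB fun e ↦ by subst e; omega
  obtain ⟨w, hwB, hwA⟩ := SetLike.exists_of_lt hlt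
  refine ⟨w, (Submodule.eq_of_le_of_finrank_le (sup_le hAB (by simpa using hwB)) ?_).symm⟩
  have : A < A ⊔ K ∙ w := lt_of_le_of_ne le_sup_left fun e ↦
    hwA (e ▸ (le_sup_right : K ∙ w ≤ A ⊔ K ∙ w) (Submodule.mem_span_singleton_self w))
  have := Submodule.finrank_lt_finrank_of_lt this
  omega

namespace LieAlgebra

open LieModule

variable {K L : Type*} [Field K] [LieRing L] [LieAlgebra K L] [FiniteDimensional K L]

namespace IsSupersolvable

lemma isSolvable (h : IsSupersolvable K L) : IsSolvable L := by
  obtain ⟨n, I, h0, hn, hle, hdim⟩ := h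
  have step (j : ℕ) (hj : j < n) : ⁅I (j + 1), I (j + 1)⁆ ≤ I j := by
    obtain ⟨w, hw⟩ := Submodule.exists_eq_sup_span_singleton
      (A := (I j).toSubmodule) (B := (I (j + 1)).toSubmodule) (hle j hj)
      ((hdim (j + 1) hj).trans (congrArg (· + 1) (hdim j hj.le).symm))
    have key (x : L) (hx : x ∈ I (j + 1)) : ∃ a ∈ I j, ∃ c : K, a + c • w = x := by
      have hx' : x ∈ (I j).toSubmodule ⊔ K ∙ w := hw ▸ hx
      obtain ⟨a, ha, b, hb, hab⟩ := Submodule.mem_sup.1 hx'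
      obtain ⟨c, rfl⟩ := Submodule.mem_span_singleton.1 hb
      exact ⟨a, ha, c, hab⟩
    rw [LieSubmodule.lie_le_iff]
    intro x hx y hy
    obtain ⟨a, ha, c, rfl⟩ := key x hx
    obtain ⟨b, hb, d, rfl⟩ := key y hy
    have : ⁅a + c • w, b + d • w⁆ = ⁅a + c • w, b⁆ + d • ⁅a, w⁆ := by simp
    rw [this]
    exact add_mem (lie_mem_right K L _ _ _ hb)
      (SMulMemClass.smul_mem d (lie_mem_left K L _ _ _ ha))
  have hD (k : ℕ) (hk : k ≤ n) : derivedSeries K L k ≤ I (n - k) := by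
    induction k with
    | zero => simp [hn]
    | succ k ih =>
      rw [derivedSeries_def, derivedSeriesOfIdeal_succ]
      have := ih (by omega)
      rw [derivedSeries_def, show n - k = n - (k + 1) + 1 by omega] at this
      exact (LieSubmodule.mono_lie this this).trans (step _ (by omega))
  refine IsSolvable.mk (R := K) (k := n) ?_
  simpa [h0] using hD n le_rfl

lemma isTriangularizable (h : IsSupersolvable K L) : IsTriangularizable K L L where
  maxGenEigenspace_eq_top x := by
    obtain ⟨n, I, h0, hn, hle, hdim⟩ := h
    have key (j : ℕ) (hj : j ≤ n) :
        (I j).toSubmodule ≤ ⨆ μ, (toEnd K L L x).maxGenEigenspace μ := by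
      induction j with
      | zero => simp [h0]
      | succ j ih =>
        specialize ih (by omega)
        obtain ⟨w, hw⟩ := Submodule.exists_eq_sup_span_singleton
          (A := (I j).toSubmodule) (B := (I (j + 1)).toSubmodule) (hle j hj)
          ((hdim (j + 1) hj).trans (congrArg (· + 1) (hdim j (by omega)).symm))
        rw [hw]
        refine sup_le ih ?_
        rw [Submodule.span_singleton_le_iff_mem]
        have hwI : w ∈ (I (j + 1)).toSubmodule :=
          hw ▸ Submodule.mem_sup_right (Submodule.mem_span_singleton_self w)
        have hxw : ⁅x, w⁆ ∈ (I j).toSubmodule ⊔ K ∙ w :=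
          hw ▸ lie_mem_right K L (I (j + 1)) x w hwI
        obtain ⟨a, ha, b, hb, hab⟩ := Submodule.mem_sup.1 hxw
        obtain ⟨c, rfl⟩ := Submodule.mem_span_singleton.1 hb
        refine Module.End.mem_iSup_maxGenEigenspace_of_sub_mem _ (c := c) (ih ?_)
        rw [toEnd_apply_apply, ← hab, add_sub_cancel_right]
        exact ha
    have := key n le_rfl
    rwa [hn, LieSubmodule.top_toSubmodule, top_le_iff] at this

end IsSupersolvable

lemma _root_.LieIdeal.derivedSeriesOfIdeal_comap_le {K L Q : Type*} [CommRing K] [LieRing L]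
    [LieAlgebra K L] [LieRing Q] [LieAlgebra K Q] (φ : L →ₗ⁅K⁆ Q) (J : LieIdeal K Q) (k : ℕ) :
    derivedSeriesOfIdeal K L k (J.comap φ) ≤ (derivedSeriesOfIdeal K Q k J).comap φ := by
  induction k with
  | zero => simp
  | succ k ih =>
    rw [derivedSeriesOfIdeal_succ, derivedSeriesOfIdeal_succ]
    exact (LieSubmodule.mono_lie ih ih).trans (LieIdeal.comap_bracket_le φ)

lemma _root_.LieIdeal.isSolvable_comap {K L Q : Type*} [CommRing K] [LieRing L]
    [LieAlgebra K L] [LieRing Q] [LieAlgebra K Q] (φ : L →ₗ⁅K⁆ Q) (J : LieIdeal K Q)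
    [IsSolvable φ.ker] [IsSolvable J] : IsSolvable (J.comap φ) := by
  obtain ⟨k, hk⟩ := IsSolvable.solvable K J
  obtain ⟨l, hl⟩ := IsSolvable.solvable K φ.ker
  rw [LieIdeal.derivedSeries_eq_bot_iff] at hk hl
  refine IsSolvable.mk (R := K) (k := l + k) ?_
  rw [LieIdeal.derivedSeries_eq_bot_iff, derivedSeriesOfIdeal_add, eq_bot_iff, ← hl]
  refine derivedSeriesOfIdeal_mono ?_ l
  refine (LieIdeal.derivedSeriesOfIdeal_comap_le φ J k).trans ?_
  rw [hk]
  intro x hx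
  simpa using hx

lemma hasTrivialRadical_of_surjective {Q : Type*} [LieRing Q] [LieAlgebra K Q]
    (φ : L →ₗ⁅K⁆ Q) (hφ : Function.Surjective φ) (hker : φ.ker = radical K L) :
    HasTrivialRadical K Q := by
  refine hasTrivialRadical_of_no_solvable_ideals fun J hJ ↦ ?_
  have : IsSolvable φ.ker := hker ▸ inferInstance
  have hle := (LieIdeal.solvable_iff_le_radical K L (J.comap φ)).1 (LieIdeal.isSolvable_comap φ J)
  rw [← hker] at hle
  refine (LieSubmodule.eq_bot_iff J).2 fun y hy ↦ ?_
  obtain ⟨x, rfl⟩ := hφ y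
  exact LieHom.mem_ker.1 (hle hy)

lemma IsKilling.exists_isSl2Triple [CharZero K] [IsKilling K L] [IsTriangularizable K L L]
    [Nontrivial L] : ∃ h e f : L, IsSl2Triple h e f := by
  obtain ⟨x, hx⟩ := exists_isCartanSubalgebra_engel K L
  set H := LieSubalgebra.engel K x
  by_cases hα : ∃ α : Weight K H L, α.IsNonZero
  · obtain ⟨α, hα⟩ := hα
    obtain ⟨h, e, f, t, -, -⟩ := IsKilling.exists_isSl2Triple_of_weight_isNonZero hα
    exact ⟨h, e, f, t⟩
  · exfalso
    have hspan := IsKilling.span_weight_isNonZero_eq_top K L H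
    have hempty : {α : Weight K H L | α.IsNonZero} = ∅ := by
      ext α; simpa using fun hα' ↦ hα ⟨α, hα'⟩
    rw [hempty, Set.image_empty, Submodule.span_empty] at hspan
    have hsub : Subsingleton (Module.Dual K H) := (Submodule.subsingleton_iff K).1
      (subsingleton_of_bot_eq_top hspan)
    have : Subsingleton H := (Module.subsingleton_dual_iff K).1 hsub
    have hnorm := LieSubalgebra.IsCartanSubalgebra.self_normalizing (H := H)
    have h0 (y : L) (hy : y ∈ H) : y = 0 :=
      congrArg Subtype.val (Subsingleton.elim (⟨y, hy⟩ : H) 0)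
    obtain ⟨y, hy⟩ := exists_ne (0 : L)
    refine hy (h0 y ?_)
    rw [← hnorm, LieSubalgebra.mem_normalizer_iff]
    intro z hz
    rw [h0 z hz, lie_zero]
    exact H.zero_mem

lemma not_isSolvable_of_isSl2Triple {K S Q : Type*} [Field K] [CharZero K] [LieRing S]
    [LieAlgebra K S] [LieRing Q] [LieAlgebra K Q] (φ : S →ₗ⁅K⁆ Q) {h e f : Q}
    (t : IsSl2Triple h e f) (he : e ∈ φ.range) (hf : f ∈ φ.range) : ¬ IsSolvable S := by
  intro hS
  have key (k : ℕ) : ∃ x ∈ derivedSeries K S k, ∃ y ∈ derivedSeries K S k,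
      φ x = e ∧ φ y = f := by
    induction k with
    | zero =>
      obtain ⟨x, rfl⟩ := he
      obtain ⟨y, rfl⟩ := hf
      exact ⟨x, by simp, y, by simp, rfl, rfl⟩
    | succ k ih =>
      obtain ⟨x, hx, y, hy, rfl, rfl⟩ := ih
      have hxy : ⁅x, y⁆ ∈ derivedSeries K S k := lie_mem_left K S _ _ _ hx
      have hmem {a b : S} (ha : a ∈ derivedSeries K S k) (hb : b ∈ derivedSeries K S k) :
          ⁅a, b⁆ ∈ derivedSeries K S (k + 1) := by
        rw [derivedSeries_def, derivedSeriesOfIdeal_succ]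
        exact LieSubmodule.lie_mem_lie ha hb
      refine ⟨(2 : K)⁻¹ • ⁅⁅x, y⁆, x⁆, SMulMemClass.smul_mem _ (hmem hxy hx),
        (2 : K)⁻¹ • ⁅y, ⁅x, y⁆⁆, SMulMemClass.smul_mem _ (hmem hy hxy), ?_, ?_⟩
      · rw [map_smul, LieHom.map_lie, LieHom.map_lie, t.lie_e_f, t.lie_h_e_smul K,
          inv_smul_smul₀ two_ne_zero]
      · rw [map_smul, LieHom.map_lie, LieHom.map_lie, t.lie_e_f, ← lie_skew,
          t.lie_lie_smul_f K, neg_neg, inv_smul_smul₀ two_ne_zero]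
  obtain ⟨k, hk⟩ := IsSolvable.solvable K S
  obtain ⟨x, hx, -, -, hxe, -⟩ := key k
  rw [hk, LieSubmodule.mem_bot] at hx
  exact t.e_ne_zero (by rw [← hxe, hx, map_zero])

/-- The canonical projection onto the quotient by a Lie ideal, as a morphism of Lie algebras. -/
def _root_.LieIdeal.quotientMk {K L : Type*} [CommRing K] [LieRing L] [LieAlgebra K L]
    (I : LieIdeal K L) : L →ₗ⁅K⁆ L ⧸ I :=
  { (LieSubmodule.Quotient.mk' I : L →ₗ[K] L ⧸ I) with
    map_lie' := fun {x y} ↦ LieSubmodule.Quotient.mk_bracket I x y }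

lemma isTriangularizable_of_forall_lieSpan
    (h : ∀ x y : L, IsSupersolvable K (LieSubalgebra.lieSpan K L {x, y})) :
    IsTriangularizable K L L where
  maxGenEigenspace_eq_top x := by
    refine eq_top_iff.2 fun y _ ↦ ?_
    set S := LieSubalgebra.lieSpan K L {x, y}
    have hx : x ∈ S := LieSubalgebra.subset_lieSpan (by simp)
    have hy : y ∈ S := LieSubalgebra.subset_lieSpan (by simp)
    have htop := (h x y).isTriangularizable.maxGenEigenspace_eq_top ⟨x, hx⟩
    refine Module.End.map_iSup_maxGenEigenspace_le (S.incl : S →ₗ[K] L)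
      (a := toEnd K S S ⟨x, hx⟩) (fun v ↦ by simp) ⟨⟨y, hy⟩, ?_, rfl⟩
    rw [htop]
    trivial

lemma isSolvable_of_forall_lieSpan [CharZero K]
    (h : ∀ x y : L, IsSupersolvable K (LieSubalgebra.lieSpan K L {x, y})) :
    IsSolvable L := by
  have hL := isTriangularizable_of_forall_lieSpan h
  set φ := (radical K L).quotientMk
  have hφ : Function.Surjective φ := LieSubmodule.Quotient.surjective_mk' _
  have hker : φ.ker = radical K L := by
    ext x
    exact LieHom.mem_ker.trans (LieSubmodule.Quotient.mk_eq_zero _)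
  have := hasTrivialRadical_of_surjective φ hφ hker
  have : IsTriangularizable K (L ⧸ radical K L) (L ⧸ radical K L) := by
    refine ⟨fun q ↦ ?_⟩
    obtain ⟨x, rfl⟩ := hφ q
    refine eq_top_iff.2 fun y _ ↦ ?_
    obtain ⟨y, rfl⟩ := hφ y
    refine Module.End.map_iSup_maxGenEigenspace_le (φ : L →ₗ[K] L ⧸ radical K L)
      (a := toEnd K L L x) (fun v ↦ by simp) ⟨y, ?_, rfl⟩
    rw [hL.maxGenEigenspace_eq_top x]
    trivial
  obtain hQ | hQ := subsingleton_or_nontrivial (L ⧸ radical K L)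
  · have htop : radical K L = ⊤ := by
      rw [← hker, eq_top_iff]
      exact fun x _ ↦ LieHom.mem_ker.2 (Subsingleton.elim _ _)
    have : IsSolvable (⊤ : LieIdeal K L) := htop ▸ inferInstance
    exact (solvable_iff_equiv_solvable LieSubalgebra.topEquiv (R := K)).1 this
  · exfalso
    obtain ⟨t₀, e, f, t⟩ := IsKilling.exists_isSl2Triple (K := K) (L := L ⧸ radical K L)
    obtain ⟨x, rfl⟩ := hφ e
    obtain ⟨y, rfl⟩ := hφ f
    set S := LieSubalgebra.lieSpan K L {x, y}
    have hx : x ∈ S := LieSubalgebra.subset_lieSpan (by simp)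
    have hy : y ∈ S := LieSubalgebra.subset_lieSpan (by simp)
    exact not_isSolvable_of_isSl2Triple (φ.comp S.incl) t ⟨⟨x, hx⟩, rfl⟩ ⟨⟨y, hy⟩, rfl⟩
      (h x y).isSolvable

lemma _root_.LieSubmodule.exists_le_finrank_eq_succ {K L M : Type*} [Field K] [LieRing L]
    [LieAlgebra K L] [AddCommGroup M] [Module K M] [LieRingModule L M] [LieModule K L M]
    [FiniteDimensional K M] [CharZero K]
    [IsSolvable L] [IsTriangularizable K L M] (N : LieSubmodule K L M) (hN : N ≠ ⊤) :
    ∃ N' : LieSubmodule K L M, N ≤ N' ∧ Module.finrank K N' = Module.finrank K N + 1 := by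
  have : IsTriangularizable K L (M ⧸ N) := by
    refine ⟨fun x ↦ eq_top_iff.2 fun y _ ↦ ?_⟩
    obtain ⟨y, rfl⟩ := LieSubmodule.Quotient.surjective_mk' N y
    refine Module.End.map_iSup_maxGenEigenspace_le
      (LieSubmodule.Quotient.mk' N : M →ₗ[K] M ⧸ N)
      (a := toEnd K L M x) (fun v ↦ by simp) ⟨y, ?_, rfl⟩
    rw [IsTriangularizable.maxGenEigenspace_eq_top x]
    trivial
  have : Nontrivial (M ⧸ N) := by
    rw [← not_subsingleton_iff_nontrivial]
    intro hs
    refine hN (eq_top_iff.2 fun m _ ↦ ?_)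
    exact (LieSubmodule.Quotient.mk_eq_zero N).1 (Subsingleton.elim _ _)
  obtain ⟨χ, hχ⟩ := exists_nontrivial_weightSpace_of_isSolvable K L (M ⧸ N)
  obtain ⟨⟨q, hq⟩, hq0⟩ := exists_ne (0 : weightSpace (M ⧸ N) χ)
  rw [mem_weightSpace] at hq
  obtain ⟨v, rfl⟩ := LieSubmodule.Quotient.surjective_mk' N q
  have hvN : v ∉ N := fun hv ↦ hq0 (Subtype.ext ((LieSubmodule.Quotient.mk_eq_zero N).2 hv))
  have hlie (x : L) : ⁅x, v⁆ - χ x • v ∈ N := by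
    rw [← LieSubmodule.Quotient.mk_eq_zero, map_sub, map_smul, LieModuleHom.map_lie, hq x, sub_self]
  refine ⟨{ N.toSubmodule ⊔ K ∙ v with lie_mem := ?_ }, ?_, ?_⟩
  · intro x m hm
    obtain ⟨a, ha, b, hb, rfl⟩ := Submodule.mem_sup.1 hm
    obtain ⟨c, rfl⟩ := Submodule.mem_span_singleton.1 hb
    refine Submodule.mem_sup.2 ⟨⁅x, a⁆ + c • (⁅x, v⁆ - χ x • v), ?_, (c * χ x) • v,
      Submodule.smul_mem _ _ (Submodule.mem_span_singleton_self v), ?_⟩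
    · exact add_mem (N.lie_mem ha) (SMulMemClass.smul_mem c (hlie x))
    · simp only [lie_add, lie_smul, smul_sub, mul_smul]
      abel
  · exact fun m hm ↦ Submodule.mem_sup_left hm
  · change Module.finrank K ↥(N.toSubmodule ⊔ K ∙ v) = Module.finrank K N.toSubmodule + 1
    have hv0 : v ≠ 0 := fun hv ↦ hvN (hv ▸ N.zero_mem)
    have hdisj : N.toSubmodule ⊓ K ∙ v = ⊥ :=
      disjoint_iff.1 ((Submodule.disjoint_span_singleton' hv0).2 hvN)
    have := Submodule.finrank_sup_add_finrank_inf_eq N.toSubmodule (K ∙ v)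
    rwa [hdisj, finrank_bot, finrank_span_singleton hv0, add_zero] at this

lemma isSupersolvable_of_isTriangularizable [CharZero K] [IsSolvable L]
    [IsTriangularizable K L L] : IsSupersolvable K L := by
  choose! g hle hg using fun N : LieIdeal K L ↦ LieSubmodule.exists_le_finrank_eq_succ N
  have hdim (j : ℕ) (hj : j ≤ Module.finrank K L) :
      Module.finrank K (g^[j] ⊥ : LieIdeal K L) = j := by
    induction j with
    | zero => exact finrank_bot K L
    | succ j ih =>
      rw [Function.iterate_succ_apply', hg, ih (by omega)]
      intro htop
      have := ih (by omega)
      rw [htop] at this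
      have h2 : Module.finrank K (⊤ : LieIdeal K L) = Module.finrank K L := finrank_top K L
      omega
  refine ⟨Module.finrank K L, fun j ↦ g^[j] ⊥, rfl, ?_, fun j hj ↦ ?_, hdim⟩
  · rw [← LieSubmodule.toSubmodule_eq_top]
    exact Submodule.eq_top_of_finrank_eq (hdim _ le_rfl)
  · change g^[j] ⊥ ≤ g^[j + 1] ⊥
    rw [Function.iterate_succ_apply']
    refine hle _ fun htop ↦ ?_
    have h1 := hdim j hj.le
    rw [htop] at h1
    have h2 : Module.finrank K (⊤ : LieIdeal K L) = Module.finrank K L := finrank_top K L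
    omega

end LieAlgebra

/-- Theorem 5 (characteristic 0 case): supersolvability is 2-recognizable for
finite-dimensional Lie algebras over a field of characteristic 0. -/
theorem isSupersolvable_of_two_generated_charZero
    (K : Type*) (L : Type*) [Field K] [CharZero K]
    [LieRing L] [LieAlgebra K L] [FiniteDimensional K L]
    (h : ∀ x y : L, LieAlgebra.IsSupersolvable K (LieSubalgebra.lieSpan K L {x, y})) :
    LieAlgebra.IsSupersolvable K L := by
  have := LieAlgebra.isSolvable_of_forall_lieSpan h
  have := LieAlgebra.isTriangularizable_of_forall_lieSpan h
  exact LieAlgebra.isSupersolvable_of_isTriangularizable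
end

section
/- Let K be an algebraically closed field of characteristic greater than 5 and let L be a finite-dimensional Lie algebra over K. If for every pair of elements x, y ∈ L the Lie subalgebra of L generated by {x, y} is supersolvable, then L is supersolvable. -/
namespace Module.End

variable {K V : Type*} [Field K] [IsAlgClosed K] [AddCommGroup V] [Module K V]
  [FiniteDimensional K V]

/-- An endomorphism preserving `P` and `Q`, with `Q` not contained in `P`, has an eigenvector in
`Q` modulo `P`. -/
theorem exists_apply_sub_smul_mem (f : End K V) {P Q : Submodule K V}
    (hP : ∀ v ∈ P, f v ∈ P) (hQ : ∀ v ∈ Q, f v ∈ Q) (hQP : ¬ Q ≤ P) :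
    ∃ c : K, ∃ v ∈ Q, v ∉ P ∧ f v - c • v ∈ P := by
  have hg : ∀ w ∈ Q.map P.mkQ, P.mapQ P f hP w ∈ Q.map P.mkQ := by
    rintro _ ⟨v, hv, rfl⟩
    exact ⟨f v, hQ v hv, rfl⟩
  have : Nontrivial (Q.map P.mkQ) := by
    rw [Submodule.nontrivial_iff_ne_bot]
    rwa [Ne, ← LinearMap.le_ker_iff_map, Submodule.ker_mkQ]
  obtain ⟨c, hc⟩ := exists_eigenvalue ((P.mapQ P f hP).restrict hg)
  obtain ⟨⟨_, v, hv, rfl⟩, hw⟩ := hc.exists_hasEigenvector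
  refine ⟨c, v, hv, fun hvP ↦ hw.2 ?_, ?_⟩
  · ext
    simpa using hvP
  · have h := congrArg Subtype.val hw.apply_eq_smul
    simp only [LinearMap.coe_restrict_apply, Submodule.coe_smul] at h
    rw [← Submodule.Quotient.mk_eq_zero, Submodule.Quotient.mk_sub, sub_eq_zero]
    exact h

/-- A pencil of endomorphisms of a nonzero space has a singular member. -/
theorem exists_apply_eq_smul_apply [Nontrivial V] (f g : End K V) (hf : Function.Injective f) :
    ∃ c : K, ∃ v : V, v ≠ 0 ∧ g v = c • f v := by
  let e := LinearEquiv.ofInjectiveEndo f hf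
  obtain ⟨c, hc⟩ := exists_eigenvalue (e.symm.toLinearMap ∘ₗ g : End K V)
  obtain ⟨v, hv⟩ := hc.exists_hasEigenvector
  refine ⟨c, v, hv.2, ?_⟩
  have h : e.symm (g v) = c • v := hv.apply_eq_smul
  rw [LinearEquiv.symm_apply_eq, map_smul] at h
  exact h

/-- An endomorphism whose only eigenvalue is zero is nilpotent. -/
theorem isNilpotent_of_forall_maxGenEigenspace_eq_bot (f : End K V)
    (h : ∀ c : K, c ≠ 0 → f.maxGenEigenspace c = ⊥) : IsNilpotent f := by
  have htop : f.maxGenEigenspace 0 = ⊤ := by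
    rw [eq_top_iff, ← f.iSup_maxGenEigenspace_eq_top]
    refine iSup_le fun c ↦ ?_
    by_cases hc : c = 0
    · rw [hc]
    · rw [h c hc]
      exact bot_le
  rw [Module.End.isNilpotent_iff_of_finite]
  intro v
  have hv : v ∈ f.maxGenEigenspace 0 := htop ▸ Submodule.mem_top
  simpa [mem_maxGenEigenspace] using hv

end Module.End

namespace LieAlgebra

open Module

section Ideal

variable {K L : Type*} [Field K] [LieRing L] [LieAlgebra K L]

/-- Commutators act nilpotently on a supersolvable Lie algebra. -/
theorem IsSupersolvable.exists_ad_lie_pow_eq_zero [FiniteDimensional K L]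
    (h : IsSupersolvable K L) (x y : L) : ∃ n : ℕ, ad K L ⁅x, y⁆ ^ n = 0 := by
  obtain ⟨n, I, h0, hn, hle, hdim⟩ := h
  suffices H : ∀ j ≤ n, ∀ z ∈ I j, (ad K L ⁅x, y⁆ ^ j) z = 0 by
    refine ⟨n, LinearMap.ext fun z ↦ H n le_rfl z ?_⟩
    rw [hn]
    exact LieSubmodule.mem_top z
  intro j
  induction j with
  | zero =>
    intro _ z hz
    simpa [h0] using hz
  | succ j ih =>
    intro hj z hz
    rw [pow_succ, Module.End.mul_apply]
    refine ih (by omega) _ ?_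
    obtain ⟨v, hv, hvI⟩ : ∃ v ∈ I (j + 1), v ∉ I j := by
      by_contra! hcon
      have := congrArg (fun J : LieIdeal K L ↦ finrank K J) (le_antisymm (hle j hj) hcon)
      simp only [hdim j (by omega), hdim (j + 1) hj] at this
      omega
    have hspan : (I j).toSubmodule ⊔ K ∙ v = (I (j + 1)).toSubmodule := by
      refine Submodule.eq_of_le_of_finrank_eq
        (sup_le (hle j hj) ((Submodule.span_singleton_le_iff_mem _ _).2 hv)) ?_
      rw [Submodule.finrank_sup_span_singleton hvI]
      exact (congrArg (· + 1) (hdim j (by omega))).trans (hdim (j + 1) hj).symm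
    have hdecomp : ∀ w ∈ I (j + 1), ∃ c : K, ∃ u ∈ I j, w = u + c • v := by
      intro w hw
      have hw' : w ∈ (I j).toSubmodule ⊔ K ∙ v := hspan ▸ hw
      obtain ⟨u, hu, t, ht, rfl⟩ := Submodule.mem_sup.1 hw'
      obtain ⟨c, rfl⟩ := Submodule.mem_span_singleton.1 ht
      exact ⟨c, u, hu, rfl⟩
    obtain ⟨a, u, hu, hxv⟩ := hdecomp ⁅x, v⁆ (lie_mem_right K L _ _ _ hv)
    obtain ⟨b, w, hw, hyv⟩ := hdecomp ⁅y, v⁆ (lie_mem_right K L _ _ _ hv)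
    obtain ⟨c, t, ht, rfl⟩ := hdecomp z hz
    have hkey : ⁅⁅x, y⁆, v⁆ = (⁅x, w⁆ - ⁅y, u⁆) + (b • u - a • w) := by
      rw [lie_lie, hxv, hyv, lie_add, lie_add, lie_smul, lie_smul, hxv, hyv]
      module
    rw [ad_apply, lie_add, lie_smul, hkey]
    refine add_mem (lie_mem_right K L _ _ _ ht) (Submodule.smul_mem _ _ ?_)
    exact add_mem (sub_mem (lie_mem_right K L _ _ _ hw) (lie_mem_right K L _ _ _ hu))
      (sub_mem (Submodule.smul_mem _ _ hu) (Submodule.smul_mem _ _ hw))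

/-- If adding one dimension at a time to a proper ideal is always possible, the Lie algebra is
supersolvable. -/
theorem isSupersolvable_of_forall_exists_finrank_eq_add_one [FiniteDimensional K L]
    (h : ∀ I : LieIdeal K L, I ≠ ⊤ → ∃ J : LieIdeal K L, I ≤ J ∧ finrank K J = finrank K I + 1) :
    IsSupersolvable K L := by
  choose! next hle hdim using h
  have hfin : ∀ j ≤ finrank K L, finrank K (next^[j] ⊥) = j := by
    intro j
    induction j with
    | zero => exact fun _ ↦ finrank_bot K L
    | succ j ih =>
      intro hj
      have hij := ih (by omega)
      rw [Function.iterate_succ_apply', hdim, hij]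
      intro htop
      rw [htop] at hij
      have : finrank K (⊤ : LieIdeal K L) = finrank K L := finrank_top K L
      omega
  have htop {j : ℕ} (hj : j < finrank K L) : next^[j] ⊥ ≠ (⊤ : LieIdeal K L) := by
    intro htop
    have hij := hfin j hj.le
    rw [htop] at hij
    have : finrank K (⊤ : LieIdeal K L) = finrank K L := finrank_top K L
    omega
  refine ⟨finrank K L, fun j ↦ next^[j] ⊥, rfl, ?_, fun j hj ↦ ?_, hfin⟩
  · exact LieSubmodule.toSubmodule_injective
      (Submodule.eq_top_of_finrank_eq (hfin _ le_rfl))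
  · simp only [Function.iterate_succ_apply']
    exact hle _ (htop hj)

/-- A form of Engel's theorem for a set `S` of ad-nilpotent elements closed under the bracket:
modulo any stable subspace `U`, any set `X` that is stable under `S` and not contained in `U`
contains an element outside `U` annihilated by `S`. -/
theorem exists_notMem_forall_lie_mem [FiniteDimensional K L] {S : Set L}
    (hS : ∀ s ∈ S, ∀ t ∈ S, ⁅s, t⁆ ∈ S) (hnil : ∀ s ∈ S, IsNilpotent (ad K L s))
    (U : Submodule K L) (hU : ∀ x : L, ∀ u ∈ U, ⁅x, u⁆ ∈ U)
    (X : Set L) (hX : ∀ s ∈ S, ∀ x ∈ X, ⁅s, x⁆ ∈ X) (hXU : ¬ X ⊆ U) :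
    ∃ w ∈ X, w ∉ U ∧ ∀ s ∈ S, ⁅s, w⁆ ∈ U := by
  let P : LieSubalgebra K L → Prop := fun B ↦ ∀ U : Submodule K L,
    (∀ b ∈ B, ∀ u ∈ U, ⁅b, u⁆ ∈ U) → ∀ X : Set L, (∀ s ∈ S, s ∈ B → ∀ x ∈ X, ⁅s, x⁆ ∈ X) →
    ¬ X ⊆ U → ∃ w ∈ X, w ∉ U ∧ ∀ b ∈ B, ⁅b, w⁆ ∈ U
  have hbot : P ⊥ := by
    intro U _ X _ hXU
    obtain ⟨w, hw, hwU⟩ := Set.not_subset.1 hXU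
    refine ⟨w, hw, hwU, fun b hb ↦ ?_⟩
    rw [(LieSubalgebra.mem_bot b).1 hb, zero_lie]
    exact U.zero_mem
  obtain ⟨B, hB, hmax⟩ := wellFounded_gt.has_min {B : LieSubalgebra K L | P B} ⟨⊥, hbot⟩
  suffices hSB : S ⊆ B by
    obtain ⟨w, hw, hwU, h⟩ := hB U (fun b _ ↦ hU b) X (fun s hs _ ↦ hX s hs) hXU
    exact ⟨w, hw, hwU, fun s hs ↦ h s (hSB hs)⟩
  by_contra hSB
  obtain ⟨s, hs, hsB, hBs⟩ := hB B.toSubmodule (fun b hb u hu ↦ B.lie_mem hb hu) S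
    (fun t ht _ x hx ↦ hS t ht x hx) hSB
  have hmem {z : L} : z ∈ B.toSubmodule ⊔ K ∙ s ↔ ∃ b ∈ B, ∃ c : K, z = b + c • s := by
    rw [Submodule.mem_sup]
    constructor
    · rintro ⟨b, hb, t, ht, rfl⟩
      obtain ⟨c, rfl⟩ := Submodule.mem_span_singleton.1 ht
      exact ⟨b, hb, c, rfl⟩
    · rintro ⟨b, hb, c, rfl⟩
      exact ⟨b, hb, c • s, Submodule.smul_mem _ _ (Submodule.mem_span_singleton_self s), rfl⟩
  let B' : LieSubalgebra K L :=
    { B.toSubmodule ⊔ K ∙ s with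
      lie_mem' := by
        intro x y hx hy
        obtain ⟨a, ha, c, rfl⟩ := hmem.1 hx
        obtain ⟨b, hb, d, rfl⟩ := hmem.1 hy
        refine hmem.2 ⟨⁅a, b⁆ + d • ⁅a, s⁆ - c • ⁅b, s⁆, ?_, 0, ?_⟩
        · exact sub_mem (add_mem (B.lie_mem ha hb) (B.smul_mem _ (hBs a ha)))
            (B.smul_mem _ (hBs b hb))
        · simp only [add_lie, lie_add, smul_lie, lie_smul, lie_self, ← lie_skew s b]
          module }
  have hmem' {z : L} : z ∈ B' ↔ ∃ b ∈ B, ∃ c : K, z = b + c • s := hmem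
  have hBB' : B ≤ B' := fun b hb ↦ hmem'.2 ⟨b, hb, 0, by simp⟩
  have hsB' : s ∈ B' := hmem'.2 ⟨0, B.zero_mem, 1, by simp⟩
  refine hmax B' ?_ (lt_of_le_of_ne hBB' fun h ↦ hsB (h ▸ hsB'))
  intro U hU X hX hXU
  obtain ⟨w, hw, hwU, hBw⟩ := hB U (fun b hb ↦ hU b (hBB' hb)) X
    (fun t ht htB ↦ hX t ht (hBB' htB)) hXU
  have hpowX (k : ℕ) : (ad K L s ^ k) w ∈ X := by
    induction k with
    | zero => simpa using hw
    | succ k ih =>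
      rw [pow_succ', Module.End.mul_apply, ad_apply]
      exact hX s hs hsB' _ ih
  have hpowB (k : ℕ) : ∀ b ∈ B, ⁅b, (ad K L s ^ k) w⁆ ∈ U := by
    induction k with
    | zero => simpa using hBw
    | succ k ih =>
      intro b hb
      rw [pow_succ', Module.End.mul_apply, ad_apply, leibniz_lie]
      exact add_mem (ih _ (hBs b hb)) (hU s hsB' _ (ih b hb))
  have hex : ∃ k, (ad K L s ^ k) w ∈ U := by
    obtain ⟨k, hk⟩ := hnil s hs
    exact ⟨k, by simp [hk]⟩
  classical
  obtain ⟨k, hk⟩ : ∃ k, Nat.find hex = k + 1 := by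
    refine Nat.exists_eq_succ_of_ne_zero fun h0 ↦ hwU ?_
    simpa [h0] using Nat.find_spec hex
  refine ⟨(ad K L s ^ k) w, hpowX k, Nat.find_min hex (by omega), fun z hz ↦ ?_⟩
  obtain ⟨b, hb, c, rfl⟩ := hmem'.1 hz
  rw [add_lie, smul_lie]
  refine add_mem (hpowB k b hb) (U.smul_mem _ ?_)
  have := Nat.find_spec hex
  rwa [hk, pow_succ', Module.End.mul_apply, ad_apply] at this

end Ideal

variable {K L : Type*} [Field K] [IsAlgClosed K] [LieRing L] [LieAlgebra K L]
  [FiniteDimensional K L]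

/-- If all commutators are ad-nilpotent, every proper ideal has codimension one in some
other ideal. -/
theorem exists_lieIdeal_finrank_eq_add_one (hnil : ∀ x y : L, IsNilpotent (ad K L ⁅x, y⁆))
    (I : LieIdeal K L) (hI : I ≠ ⊤) :
    ∃ J : LieIdeal K L, I ≤ J ∧ finrank K J = finrank K I + 1 := by
  let P : LieIdeal K L :=
    { carrier := {w | ∀ x y : L, ⁅⁅x, y⁆, w⁆ ∈ I}
      add_mem' := fun ha hb x y ↦ by rw [lie_add]; exact add_mem (ha x y) (hb x y)
      zero_mem' := fun x y ↦ by rw [lie_zero]; exact zero_mem I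
      smul_mem' := fun c w hw x y ↦ by rw [lie_smul]; exact Submodule.smul_mem _ _ (hw x y)
      lie_mem := fun {z w} hw x y ↦ by
        rw [leibniz_lie]
        exact add_mem (hw _ _) (lie_mem_right K L _ _ _ (hw x y)) }
  have hIP : I < P := by
    have hIP' : I ≤ P := fun w hw x y ↦ lie_mem_right K L _ _ _ hw
    obtain ⟨w, -, hwI, hw⟩ := exists_notMem_forall_lie_mem (K := K)
      (S := {s : L | ∃ x y : L, ⁅x, y⁆ = s}) (fun s _ t _ ↦ ⟨s, t, rfl⟩)
      (by rintro _ ⟨x, y, rfl⟩; exact hnil x y) I.toSubmodule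
      (fun x u hu ↦ lie_mem_right K L _ _ _ hu) Set.univ (fun _ _ _ _ ↦ Set.mem_univ _)
      (fun h ↦ hI (eq_top_iff.2 fun z _ ↦ h (Set.mem_univ z)))
    exact lt_of_le_of_ne hIP' fun h ↦ hwI (h ▸ fun x y ↦ hw _ ⟨x, y, rfl⟩ : w ∈ I)
  have := LieSubmodule.wellFoundedLT_of_isArtinian K L L
  obtain ⟨J, ⟨hIJ, hJP⟩, hmin⟩ := wellFounded_lt.has_min
    {J : LieIdeal K L | I < J ∧ J ≤ P} ⟨P, hIP, le_rfl⟩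
  have hscalar (x : L) : ∃ c : K, ∀ v ∈ J, ⁅x, v⁆ - c • v ∈ I := by
    obtain ⟨c, v, hvJ, hvI, hv⟩ := (ad K L x).exists_apply_sub_smul_mem (P := I.toSubmodule)
      (Q := J.toSubmodule) (fun v hv ↦ lie_mem_right K L _ _ _ hv)
      (fun v hv ↦ lie_mem_right K L _ _ _ hv) hIJ.not_ge
    let E : LieIdeal K L :=
      { carrier := {w | w ∈ J ∧ ⁅x, w⁆ - c • w ∈ I}
        add_mem' := by
          rintro a b ⟨ha, ha'⟩ ⟨hb, hb'⟩
          refine ⟨add_mem ha hb, ?_⟩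
          rw [lie_add, smul_add, add_sub_add_comm]
          exact add_mem ha' hb'
        zero_mem' := ⟨zero_mem J, by simp⟩
        smul_mem' := by
          rintro d w ⟨hw, hw'⟩
          refine ⟨Submodule.smul_mem _ _ hw, ?_⟩
          rw [lie_smul, smul_comm c d, ← smul_sub]
          exact Submodule.smul_mem _ _ hw'
        lie_mem := by
          rintro y w ⟨hw, hw'⟩
          refine ⟨lie_mem_right K L _ _ _ hw, ?_⟩
          have : ⁅x, ⁅y, w⁆⁆ - c • ⁅y, w⁆ = ⁅⁅x, y⁆, w⁆ + ⁅y, ⁅x, w⁆ - c • w⁆ := by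
            rw [leibniz_lie x y w, lie_sub, lie_smul, add_sub_assoc]
          rw [this]
          exact add_mem (hJP hw x y) (lie_mem_right K L _ _ _ hw') }
    have hEJ : E ≤ J := fun w hw ↦ hw.1
    have hIE : I < E := by
      refine lt_of_le_of_ne (fun w hw ↦ ⟨hIJ.le hw, ?_⟩) fun h ↦ hvI (h ▸ ⟨hvJ, hv⟩ : v ∈ I)
      exact sub_mem (lie_mem_right K L _ _ _ hw) (Submodule.smul_mem _ _ hw)
    have hE : E = J := hEJ.eq_or_lt.resolve_right (hmin E ⟨hIE, hEJ.trans hJP⟩)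
    exact ⟨c, fun w hw ↦ (hE ▸ hw : w ∈ E).2⟩
  obtain ⟨v, hvJ, hvI⟩ := SetLike.exists_of_lt hIJ
  refine ⟨{ I.toSubmodule ⊔ K ∙ v with lie_mem := ?_ },
    (le_sup_left : I.toSubmodule ≤ I.toSubmodule ⊔ K ∙ v),
    Submodule.finrank_sup_span_singleton (p := I.toSubmodule) hvI⟩
  intro x w hw
  obtain ⟨u, hu, t, ht, rfl⟩ := Submodule.mem_sup.1 hw
  obtain ⟨d, rfl⟩ := Submodule.mem_span_singleton.1 ht
  obtain ⟨c, hc⟩ := hscalar x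
  refine Submodule.mem_sup.2 ⟨⁅x, u⁆ + d • (⁅x, v⁆ - c • v), ?_, (d * c) • v,
    Submodule.smul_mem _ _ (Submodule.mem_span_singleton_self v), ?_⟩
  · exact add_mem (lie_mem_right K L _ _ _ hu) (Submodule.smul_mem _ _ (hc v hvJ))
  · rw [lie_add, lie_smul]
    module

/-- If for all `x` and `y` some power of `ad ⁅x, y⁆` kills `x`, then all commutators are
ad-nilpotent. -/
theorem isNilpotent_ad_lie_of_forall_exists_pow_eq_zero
    (h : ∀ x y : L, ∃ n : ℕ, (ad K L ⁅x, y⁆ ^ n) x = 0) (x y : L) :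
    IsNilpotent (ad K L ⁅x, y⁆) := by
  refine Module.End.isNilpotent_of_forall_maxGenEigenspace_eq_bot _ fun c hc ↦ ?_
  have hmem (x y : L) : x ∈ (ad K L ⁅x, y⁆).maxGenEigenspace 0 := by
    simpa [Module.End.mem_maxGenEigenspace] using h x y
  have hdisj : Disjoint ((ad K L ⁅x, y⁆).maxGenEigenspace 0)
      ((ad K L ⁅x, y⁆).maxGenEigenspace c) :=
    (Module.End.independent_maxGenEigenspace (ad K L ⁅x, y⁆)).pairwiseDisjoint hc.symm
  have hx := hmem x y
  have hy : y ∈ (ad K L ⁅x, y⁆).maxGenEigenspace 0 := by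
    have h1 := hmem y (-x)
    rwa [lie_neg, lie_skew] at h1
  -- perturbing the first entry by an element commuting with the second keeps the commutator
  have key (x' y' : L) (hxy : ⁅x', y'⁆ = ⁅x, y⁆) (hx' : x' ∈ (ad K L ⁅x, y⁆).maxGenEigenspace 0)
      (u : L) (hu : u ∈ (ad K L ⁅x, y⁆).maxGenEigenspace c) (hyu : ⁅y', u⁆ = 0) : u = 0 := by
    have h1 := hmem (x' + u) y'
    have h2 : ⁅u, y'⁆ = 0 := by rw [← lie_skew, hyu, neg_zero]
    rw [add_lie, h2, add_zero, hxy] at h1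
    exact Submodule.disjoint_def.1 hdisj u (by simpa using sub_mem h1 hx') hu
  have hmaps {z : L} (hz : z ∈ (ad K L ⁅x, y⁆).maxGenEigenspace 0) :
      ∀ u ∈ (ad K L ⁅x, y⁆).maxGenEigenspace c,
        ad K L z u ∈ (ad K L ⁅x, y⁆).maxGenEigenspace c := by
    intro u hu
    have h1 := LieModule.lie_mem_maxGenEigenspace_toEnd (M := L) hz hu
    rwa [zero_add] at h1
  by_contra hne
  have : Nontrivial ((ad K L ⁅x, y⁆).maxGenEigenspace c) :=
    (Submodule.nontrivial_iff_ne_bot).2 hne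
  obtain ⟨a, ⟨u, hu⟩, hu0, hau⟩ := Module.End.exists_apply_eq_smul_apply
    ((ad K L x).restrict (hmaps hx)) ((ad K L y).restrict (hmaps hy)) (by
      rw [injective_iff_map_eq_zero]
      rintro ⟨u, hu⟩ hxu
      refine Subtype.ext (key (-y) x ?_ (neg_mem hy) u hu (congrArg Subtype.val hxu))
      rw [neg_lie, lie_skew])
  refine hu0 (Subtype.ext (key x (y - a • x) ?_ hx u hu ?_))
  · simp
  · have h1 : ⁅y, u⁆ = a • ⁅x, u⁆ := congrArg Subtype.val hau
    rw [sub_lie, smul_lie, h1, sub_self]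

end LieAlgebra

/-- Theorem 5 (algebraically closed case): supersolvability is 2-recognizable
for finite-dimensional Lie algebras over an algebraically closed field of
characteristic greater than 5. -/
theorem isSupersolvable_of_two_generated_algClosed
    (K : Type*) (L : Type*) [Field K] [IsAlgClosed K] (hchar : 5 < ringChar K)
    [LieRing L] [LieAlgebra K L] [FiniteDimensional K L]
    (h : ∀ x y : L, LieAlgebra.IsSupersolvable K (LieSubalgebra.lieSpan K L {x, y})) :
    LieAlgebra.IsSupersolvable K L := by
  refine LieAlgebra.isSupersolvable_of_forall_exists_finrank_eq_add_one
    (LieAlgebra.exists_lieIdeal_finrank_eq_add_one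
      (LieAlgebra.isNilpotent_ad_lie_of_forall_exists_pow_eq_zero fun x y ↦ ?_))
  let M := LieSubalgebra.lieSpan K L {x, y}
  let x' : M := ⟨x, LieSubalgebra.subset_lieSpan (by simp)⟩
  let y' : M := ⟨y, LieSubalgebra.subset_lieSpan (by simp)⟩
  obtain ⟨n, hn⟩ := (h x y).exists_ad_lie_pow_eq_zero x' y'
  have hcoe (k : ℕ) : (((LieAlgebra.ad K M ⁅x', y'⁆ ^ k) x' : M) : L) =
      (LieAlgebra.ad K L ⁅x, y⁆ ^ k) x := by
    induction k with
    | zero => rfl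
    | succ k ih =>
      rw [pow_succ', pow_succ', Module.End.mul_apply, Module.End.mul_apply, ← ih]
      rfl
  exact ⟨n, by rw [← hcoe, hn]; rfl⟩
end

section
/- Let L be a finite-dimensional Lie algebra over a field K and let B be a Lie ideal of L that is contained in every maximal proper Lie subalgebra of L (i.e., B ≤ M for every Lie subalgebra M of L that is a coatom in the lattice of Lie subalgebras). If the quotient Lie algebra L/B is supersolvable, then L is supersolvable. -/
open Module Module.End

/-- If `f - a` maps `v` into an `f`-invariant submodule `p` of an Artinian module, then modulo `p`
the vector `v` is a generalized `a`-eigenvector of `f`. -/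
theorem Module.End.mem_maxGenEigenspace_sup_of_sub_smul_mem {R M : Type*} [CommRing R]
    [AddCommGroup M] [Module R M] [IsArtinian R M] {f : End R M} {p : Submodule R M}
    (hp : ∀ v ∈ p, f v ∈ p) {a : R} {v : M} (hv : f v - a • v ∈ p) :
    v ∈ f.maxGenEigenspace a ⊔ p := by
  have hgp : ∀ w ∈ p, (f - a • (1 : End R M)) w ∈ p := fun w hw ↦ by
    simpa using p.sub_mem (hp w hw) (p.smul_mem a hw)
  let g : End R p := (f - a • (1 : End R M)).restrict hgp
  have hg (n : ℕ) (w : p) : (((g ^ n) w : p) : M) = ((f - a • (1 : End R M)) ^ n) w := by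
    rw [Module.End.pow_restrict n]
    rfl
  obtain ⟨n, hn⟩ := IsArtinian.monotone_stabilizes g.iterateRange
  have hb : (g ^ n) ⟨f v - a • v, hv⟩ ∈ LinearMap.range (g ^ (n + 1)) := by
    have h : LinearMap.range (g ^ n) = LinearMap.range (g ^ (n + 1)) := hn (n + 1) n.le_succ
    exact h ▸ LinearMap.mem_range_self _ _
  obtain ⟨c, hc⟩ := hb
  have hc' := congrArg (Subtype.val : p → M) hc
  rw [hg, hg] at hc'
  refine Submodule.mem_sup.mpr ⟨v - c, ?_, c, c.2, sub_add_cancel _ _⟩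
  rw [Module.End.mem_maxGenEigenspace]
  refine ⟨n + 1, ?_⟩
  rw [map_sub, hc', sub_eq_zero, pow_succ, Module.End.mul_apply]
  simp

/-- The sum of the generalized eigenspaces of `ad x`, as a Lie subalgebra. -/
def LieSubalgebra.iSupMaxGenEigenspaceAd {R L : Type*} [CommRing R] [LieRing L]
    [LieAlgebra R L] (x : L) : LieSubalgebra R L where
  toSubmodule := ⨆ a, (LieAlgebra.ad R L x).maxGenEigenspace a
  lie_mem' := by
    intro u v hu hv
    change u ∈ ⨆ a, (LieAlgebra.ad R L x).maxGenEigenspace a at hu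
    change v ∈ ⨆ a, (LieAlgebra.ad R L x).maxGenEigenspace a at hv
    change ⁅u, v⁆ ∈ ⨆ a, (LieAlgebra.ad R L x).maxGenEigenspace a
    induction hu using Submodule.iSup_induction' with
    | zero => simp
    | add u₁ u₂ _ _ h₁ h₂ => rw [add_lie]; exact add_mem h₁ h₂
    | mem a u hu =>
      induction hv using Submodule.iSup_induction' with
      | zero => simp
      | add v₁ v₂ _ _ h₁ h₂ => rw [lie_add]; exact add_mem h₁ h₂
      | mem b v hv =>
        exact Submodule.mem_iSup_of_mem (a + b) (LieModule.lie_mem_maxGenEigenspace_toEnd hu hv)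

theorem LieSubalgebra.eq_top_of_sup_eq_top_of_forall_isCoatom_le {R L : Type*} [CommRing R]
    [LieRing L] [LieAlgebra R L] [IsNoetherian R L] {B : LieSubalgebra R L}
    (hB : ∀ M : LieSubalgebra R L, IsCoatom M → B ≤ M) {U : LieSubalgebra R L}
    (hU : U.toSubmodule ⊔ B.toSubmodule = ⊤) : U = ⊤ := by
  obtain h | ⟨M, hM, hUM⟩ := eq_top_or_exists_le_coatom U
  · exact h
  · refine absurd ?_ hM.1
    rw [← LieSubalgebra.toSubmodule_inj, LieSubalgebra.top_toSubmodule, eq_top_iff, ← hU]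
    exact sup_le hUM (hB M hM)

/-- Along a chain of submodules starting in `P`, with `f` acting as the scalar `c j` on the `j`-th
successive quotient, `P` is everything as soon as it is invariant and contains the generalized
eigenspaces for the scalars that occur. -/
theorem Module.End.mem_of_chain_of_maxGenEigenspace_le {R M : Type*} [CommRing R]
    [AddCommGroup M] [Module R M] [IsArtinian R M] {f : End R M} {P : Submodule R M}
    (hP : ∀ v ∈ P, f v ∈ P) {n : ℕ} (J : ℕ → Submodule R M) (c : ℕ → R) (h0 : J 0 ≤ P)
    (hJ : ∀ j < n, ∀ v ∈ J (j + 1), f v - c j • v ∈ J j)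
    (hc : ∀ j < n, f.maxGenEigenspace (c j) ≤ P) : ∀ j ≤ n, J j ≤ P := by
  intro j
  induction j with
  | zero => exact fun _ ↦ h0
  | succ j ih =>
    intro hj v hv
    have := mem_maxGenEigenspace_sup_of_sub_smul_mem hP (ih (by lia) (hJ j hj v hv))
    rwa [sup_eq_right.mpr (hc j hj)] at this

theorem Submodule.le_sup_span_singleton_of_finrank_eq_add_one {K V : Type*} [Field K]
    [AddCommGroup V] [Module K V] {p q : Submodule K V} [FiniteDimensional K V] (hpq : p ≤ q)
    (h : finrank K q = finrank K p + 1) : ∃ v ∈ q, q ≤ p ⊔ span K {v} := by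
  obtain ⟨v, hvq, hvp⟩ : ∃ v ∈ q, v ∉ p := by
    by_contra! H
    have := Submodule.finrank_mono (R := K) (show q ≤ p from H)
    lia
  refine ⟨v, hvq, ge_of_eq (Submodule.eq_of_le_of_finrank_eq ?_ ?_)⟩
  · exact sup_le hpq ((span_singleton_le_iff_mem v q).mpr hvq)
  · rw [finrank_sup_span_singleton hvp, h]

theorem LieSubmodule.exists_lie_sub_smul_mem_of_finrank_eq_add_one {K L M : Type*} [Field K]
    [LieRing L] [LieAlgebra K L] [AddCommGroup M] [Module K M] [LieRingModule L M]
    [LieModule K L M] [FiniteDimensional K M] {N N' : LieSubmodule K L M} (hN : N ≤ N')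
    (h : finrank K N' = finrank K N + 1) (y : L) :
    ∃ c : K, ∀ v ∈ N', ⁅y, v⁆ - c • v ∈ N := by
  obtain ⟨w, hw, hle⟩ := Submodule.le_sup_span_singleton_of_finrank_eq_add_one
    (p := N.toSubmodule) (q := N'.toSubmodule) hN h
  obtain ⟨u, hu, z, hz, huz⟩ := Submodule.mem_sup.mp (hle (N'.lie_mem (x := y) hw))
  obtain ⟨c, rfl⟩ := Submodule.mem_span_singleton.mp hz
  refine ⟨c, fun v hv ↦ ?_⟩
  obtain ⟨u', hu', z', hz', rfl⟩ := Submodule.mem_sup.mp (hle hv)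
  obtain ⟨d, rfl⟩ := Submodule.mem_span_singleton.mp hz'
  have : ⁅y, u' + d • w⁆ - c • (u' + d • w) = ⁅y, u'⁆ - c • u' + d • u := by
    rw [lie_add, lie_smul, ← huz]
    module
  rw [this]
  exact add_mem (sub_mem (N.lie_mem hu') (N.smul_mem c hu')) (N.smul_mem d hu)

/-- A Lie algebra whose derived ideal acts by nilpotent endomorphisms and all of whose elements act
triangularizably has a common eigenvector. -/
theorem LieModule.exists_forall_lie_eq_smul_of_derived_isNilpotent {K L M : Type*} [Field K]
    [LieRing L] [LieAlgebra K L] [AddCommGroup M] [Module K M] [LieRingModule L M]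
    [LieModule K L M] [FiniteDimensional K M] [Nontrivial M] [IsTriangularizable K L M]
    (D : LieIdeal K L) (hLD : ∀ y z : L, ⁅y, z⁆ ∈ D)
    (hD : ∀ x ∈ D, _root_.IsNilpotent (toEnd K L M x)) :
    ∃ v : M, v ≠ 0 ∧ ∀ y : L, ∃ c : K, ⁅y, v⁆ = c • v := by
  have : LieModule.IsNilpotent D M :=
    (isNilpotent_iff_forall' (R := K)).mpr fun x ↦ hD x x.2
  let W : LieSubmodule K L M :=
    { maxTrivSubmodule K D M with
      lie_mem := by
        intro y m hm x
        have h (x : L) (hx : x ∈ D) : ⁅x, m⁆ = 0 := hm ⟨x, hx⟩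
        change ⁅(x : L), ⁅y, m⁆⁆ = 0
        rw [leibniz_lie, h x x.2, h _ (hLD _ _), lie_zero, zero_add] }
  have hW (m : M) : m ∈ W ↔ ∀ x ∈ D, ⁅x, m⁆ = 0 :=
    ⟨fun h x hx ↦ h ⟨x, hx⟩, fun h x ↦ h x x.2⟩
  have hWbot : W ≠ ⊥ := by
    have := nontrivial_max_triv_of_isNilpotent K D M
    obtain ⟨⟨m, hm⟩, hm0⟩ := exists_ne (0 : maxTrivSubmodule K D M)
    exact fun h ↦ hm0 (Subtype.ext ((LieSubmodule.eq_bot_iff W).mp h m hm))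
  obtain ⟨S, hS, hSW⟩ := (eq_bot_or_exists_atom_le W).resolve_left hWbot
  have : Nontrivial S := (LieSubmodule.nontrivial_iff_ne_bot K L M).mpr hS.1
  have hscalar (y : L) : ∃ c : K, ∀ m ∈ S, ⁅y, m⁆ = c • m := by
    obtain ⟨c, hc⟩ := IsTriangularizable.exists_hasEigenvalue K L S y
    obtain ⟨⟨m, hmS⟩, hm⟩ := hc.exists_hasEigenvector
    let E : LieSubmodule K L M :=
      { S.toSubmodule ⊓ (toEnd K L M y).eigenspace c with
        lie_mem := by
          rintro z m ⟨hm, hmc⟩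
          replace hmc : ⁅y, m⁆ = c • m := mem_eigenspace_iff.mp hmc
          refine ⟨S.lie_mem hm, mem_eigenspace_iff.mpr ?_⟩
          rw [toEnd_apply_apply, leibniz_lie, (hW m).mp (hSW hm) _ (hLD y z), zero_add, hmc,
            lie_smul] }
    have hES : E ≤ S := fun m hm ↦ hm.1
    have hmE : m ∈ E := ⟨hmS, mem_eigenspace_iff.mpr (congrArg Subtype.val hm.apply_eq_smul)⟩
    have hE : E = S := (hS.le_iff.mp hES).resolve_left fun h ↦
      hm.2 (Subtype.ext ((LieSubmodule.eq_bot_iff E).mp h m hmE))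
    exact ⟨c, fun m hm ↦ mem_eigenspace_iff.mp (hE ▸ hm : m ∈ E).2⟩
  obtain ⟨⟨v, hvS⟩, hv⟩ := exists_ne (0 : S)
  exact ⟨v, fun h ↦ hv (Subtype.ext h), fun y ↦ (hscalar y).imp fun c hc ↦ hc v hvS⟩

instance LieModule.IsTriangularizable.quotient {R L M : Type*} [CommRing R]
    [LieRing L] [LieAlgebra R L] [AddCommGroup M] [Module R M] [LieRingModule L M]
    [LieModule R L M] [IsTriangularizable R L M] (N : LieSubmodule R L M) :
    IsTriangularizable R L (M ⧸ N) where
  maxGenEigenspace_eq_top y := by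
    have hcomm (a : R) (k : ℕ) (m : M) :
        ((toEnd R L (M ⧸ N) y - a • 1) ^ k) (LieSubmodule.Quotient.mk m) =
          LieSubmodule.Quotient.mk (((toEnd R L M y - a • 1) ^ k) m) := by
      induction k generalizing m with
      | zero => rfl
      | succ k ih =>
        rw [pow_succ, pow_succ, Module.End.mul_apply, Module.End.mul_apply, ← ih]
        rfl
    have hle : ⨆ a, (toEnd R L M y).maxGenEigenspace a ≤
        (⨆ a, (toEnd R L (M ⧸ N) y).maxGenEigenspace a).comap
          (LieSubmodule.Quotient.mk' N : M →ₗ[R] M ⧸ N) := by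
      refine iSup_le fun a m hm ↦ Submodule.mem_iSup_of_mem a ?_
      obtain ⟨k, hk⟩ := (mem_maxGenEigenspace _ _ _).mp hm
      refine (mem_maxGenEigenspace _ _ _).mpr ⟨k, (hcomm a k m).trans ?_⟩
      rw [hk]
      rfl
    rw [IsTriangularizable.maxGenEigenspace_eq_top y, top_le_iff] at hle
    rw [eq_top_iff]
    intro q _
    obtain ⟨m, rfl⟩ := LieSubmodule.Quotient.surjective_mk' N q
    exact (hle ▸ Submodule.mem_top : m ∈ Submodule.comap _ _)

theorem LieSubmodule.exists_le_finrank_eq_add_one {K L M : Type*} [Field K]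
    [LieRing L] [LieAlgebra K L] [AddCommGroup M] [Module K M] [LieRingModule L M]
    [LieModule K L M] [FiniteDimensional K M] [LieModule.IsTriangularizable K L M]
    (D : LieIdeal K L) (hLD : ∀ y z : L, ⁅y, z⁆ ∈ D)
    (hD : ∀ x ∈ D, IsNilpotent (LieModule.toEnd K L M x))
    {N : LieSubmodule K L M} (hN : N ≠ ⊤) :
    ∃ N' : LieSubmodule K L M, N ≤ N' ∧ finrank K N' = finrank K N + 1 := by
  have : Nontrivial (M ⧸ N) :=
    Submodule.Quotient.nontrivial_iff.mpr fun h ↦ hN ((toSubmodule_eq_top N).mp h)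
  have hDN (x : L) (hx : x ∈ D) : IsNilpotent (LieModule.toEnd K L (M ⧸ N) x) := by
    obtain ⟨k, hk⟩ := hD x hx
    have hcomm (k : ℕ) (m : M) :
        ((LieModule.toEnd K L (M ⧸ N) x) ^ k) (Quotient.mk m) =
          Quotient.mk (((LieModule.toEnd K L M x) ^ k) m) := by
      induction k generalizing m with
      | zero => rfl
      | succ k ih =>
        rw [pow_succ, pow_succ, Module.End.mul_apply, Module.End.mul_apply, ← ih]
        rfl
    refine ⟨k, LinearMap.ext fun q ↦ ?_⟩
    obtain ⟨m, rfl⟩ := Quotient.surjective_mk' N q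
    refine (hcomm k m).trans ?_
    rw [hk]
    rfl
  obtain ⟨q, hq, hqL⟩ :=
    LieModule.exists_forall_lie_eq_smul_of_derived_isNilpotent D hLD hDN
  obtain ⟨v, rfl⟩ := Quotient.surjective_mk' N q
  have hv : v ∉ N.toSubmodule := fun h ↦ hq ((Quotient.mk_eq_zero N).mpr h)
  refine ⟨{ N.toSubmodule ⊔ Submodule.span K {v} with lie_mem := ?_ }, ?_, ?_⟩
  · intro y m hm
    change m ∈ N.toSubmodule ⊔ Submodule.span K {v} at hm
    change ⁅y, m⁆ ∈ N.toSubmodule ⊔ Submodule.span K {v}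
    obtain ⟨u, hu, z, hz, rfl⟩ := Submodule.mem_sup.mp hm
    obtain ⟨d, rfl⟩ := Submodule.mem_span_singleton.mp hz
    obtain ⟨c, hc⟩ := hqL y
    have hcN : ⁅y, v⁆ - c • v ∈ N := by
      refine (Quotient.mk_eq_zero N).mp (sub_eq_zero.mpr hc)
    have : ⁅y, u + d • v⁆ = (⁅y, u⁆ + d • (⁅y, v⁆ - c • v)) + (d * c) • v := by
      rw [lie_add, lie_smul]
      module
    rw [this]
    exact Submodule.add_mem_sup (add_mem (N.lie_mem hu) (N.smul_mem d hcN))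
      (Submodule.smul_mem _ _ (Submodule.mem_span_singleton_self v))
  · exact fun m hm ↦ Submodule.mem_sup_left hm
  · exact Submodule.finrank_sup_span_singleton hv

/-- If all `ad y` are triangularizable and the derived ideal consists of ad-nilpotent elements,
then the Lie algebra is supersolvable. -/
theorem LieAlgebra.IsSupersolvable.of_isTriangularizable {K L : Type*} [Field K]
    [LieRing L] [LieAlgebra K L] [FiniteDimensional K L] [LieModule.IsTriangularizable K L L]
    (D : LieIdeal K L) (hLD : ∀ y z : L, ⁅y, z⁆ ∈ D)
    (hD : ∀ x ∈ D, IsNilpotent (LieAlgebra.ad K L x)) : LieAlgebra.IsSupersolvable K L := by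
  have hstep (N : LieIdeal K L) :
      ∃ N' : LieIdeal K L, N ≤ N' ∧ (N ≠ ⊤ → finrank K N' = finrank K N + 1) := by
    by_cases hN : N = ⊤
    · exact ⟨N, le_rfl, fun h ↦ absurd hN h⟩
    · obtain ⟨N', h, h'⟩ := LieSubmodule.exists_le_finrank_eq_add_one D hLD hD hN
      exact ⟨N', h, fun _ ↦ h'⟩
  choose next hle hrank using hstep
  have hfin : ∀ j ≤ finrank K L, finrank K (next^[j] ⊥ : LieIdeal K L) = j := by
    intro j
    induction j with
    | zero => exact fun _ ↦ finrank_bot K L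
    | succ j ih =>
      intro hj
      have hj' := ih (by lia)
      rw [Function.iterate_succ_apply', hrank, hj']
      intro htop
      rw [htop] at hj'
      have : finrank K (⊤ : LieIdeal K L) = finrank K L := finrank_top K L
      lia
  refine ⟨finrank K L, fun j ↦ next^[j] ⊥, rfl, ?_, fun j _ ↦ ?_, hfin⟩
  · exact (LieSubmodule.toSubmodule_eq_top _).mp (Submodule.eq_top_of_finrank_eq (hfin _ le_rfl))
  · simpa only [Function.iterate_succ_apply'] using hle _

/-- Theorem 6: if `B` is a Lie ideal contained in every maximal proper Lie
subalgebra of `L` (i.e. contained in the Frattini ideal) and `L/B` is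
supersolvable, then `L` is supersolvable. -/
theorem isSupersolvable_of_quotient_frattini
    (K : Type*) (L : Type*) [Field K]
    [LieRing L] [LieAlgebra K L] [FiniteDimensional K L]
    (B : LieIdeal K L)
    (hB : ∀ M : LieSubalgebra K L, IsCoatom M → (B : LieSubalgebra K L) ≤ M)
    (h : LieAlgebra.IsSupersolvable K (L ⧸ B)) :
    LieAlgebra.IsSupersolvable K L := by
  obtain ⟨n, I, hI0, hIn, hImono, hIrank⟩ := h
  let π : L →ₗ[K] L ⧸ B := LieSubmodule.Quotient.mk' B
  have hπ (y v : L) : π ⁅y, v⁆ = ⁅π y, π v⁆ := rfl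
  have hπB (v : L) : π v = 0 ↔ v ∈ B := LieSubmodule.Quotient.mk_eq_zero B
  let J (j : ℕ) : Submodule K L := (I j).toSubmodule.comap π
  have hscalar (j : ℕ) (hj : j < n) (q : L ⧸ B) : ∃ c : K, ∀ v ∈ I (j + 1),
      ⁅q, v⁆ - c • v ∈ I j :=
    LieSubmodule.exists_lie_sub_smul_mem_of_finrank_eq_add_one (hImono j hj)
      (by rw [hIrank _ hj, hIrank _ hj.le]) q
  -- A subalgebra containing enough generalized eigenspaces of `ad y` supplements `B`.
  have key (y : L) (c : ℕ → K) (hc : ∀ j < n, ∀ v ∈ J (j + 1), ⁅y, v⁆ - c j • v ∈ J j)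
      (U : LieSubalgebra K L) (hyU : ∀ u ∈ U, ⁅y, u⁆ ∈ U)
      (hU : ∀ j < n, (LieAlgebra.ad K L y).maxGenEigenspace (c j) ≤ U.toSubmodule) : U = ⊤ := by
    refine LieSubalgebra.eq_top_of_sup_eq_top_of_forall_isCoatom_le hB ?_
    have hinv : ∀ v ∈ U.toSubmodule ⊔ B.toSubmodule,
        LieAlgebra.ad K L y v ∈ U.toSubmodule ⊔ B.toSubmodule := by
      intro v hv
      obtain ⟨u, hu, b, hb, rfl⟩ := Submodule.mem_sup.mp hv
      rw [map_add]
      exact Submodule.add_mem_sup (hyU u hu) (B.lie_mem hb)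
    have hJ0 : J 0 ≤ U.toSubmodule ⊔ B.toSubmodule := by
      intro v hv
      refine Submodule.mem_sup_right ((hπB v).mp ?_)
      simpa [J, hI0] using hv
    have := mem_of_chain_of_maxGenEigenspace_le hinv J c hJ0 hc
      (fun j hj ↦ (hU j hj).trans le_sup_left) n le_rfl
    refine eq_top_iff.mpr (le_trans ?_ this)
    simp [J, hIn]
  have : LieModule.IsTriangularizable K L L := by
    refine ⟨fun y ↦ ?_⟩
    have hex (j : ℕ) : ∃ c : K, j < n → ∀ v ∈ J (j + 1), ⁅y, v⁆ - c • v ∈ J j := by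
      by_cases hj : j < n
      · obtain ⟨c, hc⟩ := hscalar j hj (π y)
        refine ⟨c, fun _ v hv ↦ ?_⟩
        change π (⁅y, v⁆ - c • v) ∈ I j
        rw [map_sub, map_smul, hπ]
        exact hc _ hv
      · exact ⟨0, fun h ↦ absurd h hj⟩
    choose c hc using hex
    have hself : y ∈ LieSubalgebra.iSupMaxGenEigenspaceAd (R := K) y :=
      Submodule.mem_iSup_of_mem (0 : K) (LieSubalgebra.self_mem_engel K y)
    have := key y c hc (LieSubalgebra.iSupMaxGenEigenspaceAd y)
      (fun u hu ↦ LieSubalgebra.lie_mem _ hself hu)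
      (fun j _ ↦ le_iSup (LieAlgebra.ad K L y).maxGenEigenspace (c j))
    exact congrArg LieSubalgebra.toSubmodule this
  refine LieAlgebra.IsSupersolvable.of_isTriangularizable ⁅(⊤ : LieIdeal K L), (⊤ : LieIdeal K L)⁆
    (fun y z ↦ LieSubmodule.lie_mem_lie (LieSubmodule.mem_top y) (LieSubmodule.mem_top z))
    fun x hx ↦ ?_
  have hxJ : ∀ j < n, ∀ v ∈ J (j + 1), ⁅x, v⁆ ∈ J j := by
    intro j hj v hv
    rw [← LieSubmodule.mem_toSubmodule, LieSubmodule.lieIdeal_oper_eq_linear_span'] at hx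
    induction hx using Submodule.span_induction with
    | zero => simp
    | add x₁ x₂ _ _ h₁ h₂ => rw [add_lie]; exact add_mem h₁ h₂
    | smul a x _ h => rw [smul_lie]; exact Submodule.smul_mem _ a h
    | mem x hx =>
      obtain ⟨y, -, z, -, rfl⟩ := hx
      obtain ⟨a, ha⟩ := hscalar j hj (π y)
      obtain ⟨b, hb⟩ := hscalar j hj (π z)
      have hyv := ha _ ((I (j + 1)).lie_mem (x := π z) hv)
      have hzv := hb _ ((I (j + 1)).lie_mem (x := π y) hv)
      change π ⁅⁅y, z⁆, v⁆ ∈ I j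
      have : π ⁅⁅y, z⁆, v⁆ = (⁅π y, ⁅π z, π v⁆⁆ - a • ⁅π z, π v⁆)
          - (⁅π z, ⁅π y, π v⁆⁆ - b • ⁅π y, π v⁆)
          + (a • (⁅π z, π v⁆ - b • π v) - b • (⁅π y, π v⁆ - a • π v)) := by
        rw [hπ, hπ, lie_lie]
        module
      rw [this]
      exact add_mem (sub_mem hyv hzv) (sub_mem ((I j).smul_mem a (hb _ hv))
        ((I j).smul_mem b (ha _ hv)))
  have htop : LieSubalgebra.engel K x = ⊤ :=
    key x 0 (by simpa using hxJ) _
      (fun u hu ↦ LieSubalgebra.lie_mem _ (LieSubalgebra.self_mem_engel K x) hu)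
      (fun j _ ↦ le_rfl)
  refine (Module.End.isNilpotent_iff_of_finite).mpr fun v ↦ ?_
  exact (LieSubalgebra.mem_engel_iff K x v).mp (htop ▸ LieSubalgebra.mem_top v)
end
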